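/- arXiv:2302.13844 — 3 statements merged into one kernel-verified Lean document; each statement's English description precedes it below -/
import Mathlib

section
/- Let T = [a_1, b_1] × … × [a_N, b_N] ⊆ ℝ^N be a product of nondegenerate compact intervals and F : ℝ^N → ℝ^N continuous. Suppose the isolation inequalities hold: for each coordinate k, F_k(x) > 0 for every x ∈ T with x_k = a_k (the k-th left face), and F_k(x) < 0 for every x ∈ T with x_k = b_k (the k-th right face). Then there exists γ₀ > 0 such that for every γ with 0 < γ < γ₀, T is a trapping region, i.e. x + γ·F(x) ∈ interior(T) for every x ∈ T. -/
/-- If `h` is nonnegative on a compact set and `g` is positive at the zeros of `h` there, then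
`h + γ * g` is positive on that set for all sufficiently small `γ > 0`. -/
theorem IsCompact.eventually_forall_pos_add_mul {X : Type*} [TopologicalSpace X] {K : Set X}
    (hK : IsCompact K) {h g : X → ℝ} (hh : Continuous h) (hg : Continuous g)
    (h_nonneg : ∀ x ∈ K, 0 ≤ h x) (g_pos : ∀ x ∈ K, h x = 0 → 0 < g x) :
    ∀ᶠ γ : ℝ in nhds 0, ∀ x ∈ K, 0 < γ → 0 < h x + γ * g x := by
  suffices ∀ᶠ γ : ℝ in nhds 0, ∀ x ∈ K, x ∈ K → 0 < γ → 0 < h x + γ * g x from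
    this.mono fun γ H x hx => H x hx hx
  refine hK.eventually_forall_of_forall_eventually fun x hx => ?_
  rcases (h_nonneg x hx).eq_or_lt with h_zero | h_pos
  · have hg_near : ∀ᶠ z : ℝ × X in nhds (0, x), 0 < g z.2 :=
      (hg.comp continuous_snd).continuousAt.eventually_const_lt (g_pos x hx h_zero.symm)
    filter_upwards [hg_near] with z hz hzK hγ
    exact add_pos_of_nonneg_of_pos (h_nonneg _ hzK) (mul_pos hγ hz)
  · have h_cont : Continuous fun z : ℝ × X => h z.2 + z.1 * g z.2 := by fun_prop
    have h_near : ∀ᶠ z : ℝ × X in nhds (0, x), 0 < h z.2 + z.1 * g z.2 :=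
      h_cont.continuousAt.eventually_const_lt (by simpa using h_pos)
    filter_upwards [h_near] with z hz _ _ using hz


/-- Isolation inequalities on the faces of a product of nondegenerate compact intervals imply
that it is a trapping region for all sufficiently small learning rates. -/
theorem isolation_implies_trapping {N : ℕ}
    (a b : Fin N → ℝ) (hab : ∀ k, a k < b k)
    (F : EuclideanSpace ℝ (Fin N) → EuclideanSpace ℝ (Fin N))
    (hF : Continuous F)
    (T : Set (EuclideanSpace ℝ (Fin N)))
    (hTdef : T = WithLp.ofLp ⁻¹' Set.pi Set.univ fun k => Set.Icc (a k) (b k))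
    (hleft : ∀ k : Fin N, ∀ x ∈ T, x k = a k → 0 < F x k)
    (hright : ∀ k : Fin N, ∀ x ∈ T, x k = b k → F x k < 0) :
    ∃ γ₀ > 0, ∀ γ : ℝ, 0 < γ → γ < γ₀ → ∀ x ∈ T, x + γ • F x ∈ interior T := by
  have hT_mem : ∀ x, x ∈ T ↔ ∀ k, a k ≤ x k ∧ x k ≤ b k := fun x => by
    simp [hTdef, Pi.le_def, forall_and]
  have hT_compact : IsCompact T := by
    rw [hTdef]
    exact (EuclideanSpace.equiv (Fin N) ℝ).toHomeomorph.isCompact_preimage.2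
      (isCompact_univ_pi fun k => isCompact_Icc)
  have h_interior : ∀ x : EuclideanSpace ℝ (Fin N), (∀ k, a k < x k ∧ x k < b k) →
      x ∈ interior T := fun x hx => by
    have h_open : IsOpen (WithLp.ofLp ⁻¹' Set.pi Set.univ fun k => Set.Ioo (a k) (b k) :
        Set (EuclideanSpace ℝ (Fin N))) :=
      (isOpen_set_pi Set.finite_univ fun k _ => isOpen_Ioo).preimage
        (PiLp.continuous_ofLp 2 _)
    refine interior_maximal ?_ h_open fun k _ => hx k
    rw [hTdef]
    exact Set.preimage_mono (Set.pi_mono fun k _ => Set.Ioo_subset_Icc_self)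
  have h_above : ∀ᶠ γ : ℝ in nhds 0, ∀ k, ∀ x ∈ T, 0 < γ → 0 < (x k - a k) + γ * F x k :=
    Filter.eventually_all.2 fun k => hT_compact.eventually_forall_pos_add_mul
      (by fun_prop) (by fun_prop) (fun x hx => sub_nonneg.2 ((hT_mem x).1 hx k).1)
      fun x hx hxk => hleft k x hx (sub_eq_zero.1 hxk)
  have h_below : ∀ᶠ γ : ℝ in nhds 0, ∀ k, ∀ x ∈ T, 0 < γ → 0 < (b k - x k) + γ * -F x k :=
    Filter.eventually_all.2 fun k => hT_compact.eventually_forall_pos_add_mul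
      (by fun_prop) (by fun_prop) (fun x hx => sub_nonneg.2 ((hT_mem x).1 hx k).2)
      fun x hx hxk => neg_pos.2 (hright k x hx (sub_eq_zero.1 hxk).symm)
  obtain ⟨γ₀, hγ₀, hball⟩ := Metric.eventually_nhds_iff.1 (h_above.and h_below)
  refine ⟨γ₀, hγ₀, fun γ hγ hγlt x hx => h_interior _ fun k => ?_⟩
  obtain ⟨h1, h2⟩ := hball (y := γ) (by rwa [Real.dist_0_eq_abs, abs_of_pos hγ])
  have hlower := h1 k x hx hγ
  have hupper := h2 k x hx hγ
  simp only [PiLp.add_apply, PiLp.smul_apply, smul_eq_mul]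
  constructor <;> linarith
end

section
/- Let T = [a_1, b_1] × … × [a_N, b_N] ⊆ ℝ^N be a product of nondegenerate compact intervals and let F : ℝ^N → ℝ^N be Lipschitz continuous on T with Lipschitz constant at most L > 0. Suppose the isolation inequalities hold: for each coordinate k, F_k(x) > 0 on the k-th left face and F_k(x) < 0 on the k-th right face. Let m = min over all coordinates k of the minimum of |F_k| over the k-th left and right faces, and let B = max_{x∈T} ‖F(x)‖_∞ (the maximum over T of the sup-norm of F). Then for every γ with 0 < γ < m/(L·B), T is a trapping region, i.e. x + γ·F(x) ∈ interior(T) for every x ∈ T. -/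
/-- Moving the `k`-th coordinate of a point to `c` changes each coordinate of an `L`-Lipschitz map
by at most `L * |x k - c|`. -/
theorem abs_apply_sub_apply_add_single_le {ι : Type*} [Fintype ι] [DecidableEq ι]
    {F : EuclideanSpace ℝ ι → EuclideanSpace ℝ ι} {T : Set (EuclideanSpace ℝ ι)} {L : ℝ}
    (hLip : ∀ x ∈ T, ∀ y ∈ T, ‖F x - F y‖ ≤ L * ‖x - y‖) {x : EuclideanSpace ℝ ι} {k : ι} {c : ℝ}
    (hx : x ∈ T) (hy : x + EuclideanSpace.single k (c - x k) ∈ T) (j : ι) :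
    |F x j - F (x + EuclideanSpace.single k (c - x k)) j| ≤ L * |x k - c| := by
  have h := (PiLp.norm_apply_le (F x - F (x + EuclideanSpace.single k (c - x k))) j).trans
    (hLip x hx _ hy)
  simpa [Real.norm_eq_abs, abs_sub_comm] using h

/-- Explicit upper bound on the learning rate for a product of intervals with Lipschitz
learning dynamics satisfying the isolation inequalities: for every
`0 < γ < m / (L * B)`, where `m` is the minimum of `|F_k|` over the left and right faces
and `B` is the maximum of the sup-norm of `F` over `T`, the set `T` is a trapping region. -/
theorem isolation_lipschitz_explicit_rate_bound {N : ℕ}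
    (a b : Fin N → ℝ) (hab : ∀ k, a k < b k)
    (F : EuclideanSpace ℝ (Fin N) → EuclideanSpace ℝ (Fin N))
    (T : Set (EuclideanSpace ℝ (Fin N)))
    (hTdef : T = WithLp.ofLp ⁻¹' (Set.pi Set.univ fun k => Set.Icc (a k) (b k)))
    (L : ℝ) (hL : 0 < L)
    (hLip : ∀ x ∈ T, ∀ y ∈ T, ‖F x - F y‖ ≤ L * ‖x - y‖)
    (hleft : ∀ k : Fin N, ∀ x ∈ T, x k = a k → 0 < F x k)
    (hright : ∀ k : Fin N, ∀ x ∈ T, x k = b k → F x k < 0)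
    (m B : ℝ)
    (hm : IsLeast {v : ℝ | ∃ k : Fin N, ∃ x ∈ T, (x k = a k ∨ x k = b k) ∧ v = |F x k|} m)
    (hB : IsGreatest {v : ℝ | ∃ x ∈ T, v = ⨆ k : Fin N, |F x k|} B) :
    ∀ γ : ℝ, 0 < γ → γ < m / (L * B) → ∀ x ∈ T, x + γ • F x ∈ interior T := by
  intro γ hγ hγm x hx
  obtain ⟨⟨k₀, x₀, hx₀, hface₀, hm₀⟩, hmle⟩ := hm
  have hle : ∀ z ∈ T, ∀ k, |F z k| ≤ B := fun z hz k ↦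
    (le_ciSup (f := fun k ↦ |F z k|) (Set.finite_range _).bddAbove k).trans (hB.2 ⟨z, hz, rfl⟩)
  have hm_pos : 0 < m := by
    rw [hm₀, abs_pos]
    rcases hface₀ with h | h
    · exact (hleft k₀ x₀ hx₀ h).ne'
    · exact (hright k₀ x₀ hx₀ h).ne
  have hB_pos : 0 < B := hm_pos.trans_le (hm₀.trans_le (hle x₀ hx₀ k₀))
  rw [lt_div_iff₀ (mul_pos hL hB_pos)] at hγm
  have hmem : ∀ z, z ∈ T ↔ ∀ k, a k ≤ z k ∧ z k ≤ b k := by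
    intro z
    simp [hTdef, Pi.le_def, forall_and]
  have hstep : ∀ k, L * (γ * |F x k|) < m := fun k ↦ by
    have := mul_le_mul_of_nonneg_left (hle x hx k) (mul_pos hL hγ).le
    linarith
  have hmove : ∀ k c, a k ≤ c → c ≤ b k → x + EuclideanSpace.single k (c - x k) ∈ T := by
    intro k c hac hcb
    rw [hmem] at hx ⊢
    intro j
    rcases eq_or_ne j k with rfl | hj
    · simpa using ⟨hac, hcb⟩
    · simpa [hj] using hx j
  have hinner : ∀ k, a k < (x + γ • F x) k ∧ (x + γ • F x) k < b k := by
    intro k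
    obtain ⟨hak, hbk⟩ := (hmem x).1 hx k
    simp only [PiLp.add_apply, PiLp.smul_apply, smul_eq_mul]
    constructor
    · rcases le_or_gt 0 (F x k) with h | h
      · rcases hak.eq_or_lt with h' | h'
        · linarith [mul_pos hγ (hleft k x hx h'.symm)]
        · linarith [mul_nonneg hγ.le h]
      · have hy := hmove k (a k) le_rfl (hab k).le
        have hd := abs_apply_sub_apply_add_single_le hLip hx hy k
        have hyk : (x + EuclideanSpace.single k (a k - x k)) k = a k := by simp
        have hpos := hleft k _ hy hyk
        have hmy := hmle ⟨k, _, hy, Or.inl hyk, rfl⟩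
        rw [abs_of_pos hpos] at hmy
        rw [abs_of_nonneg (sub_nonneg.2 hak)] at hd
        have hs := hstep k
        rw [abs_of_neg h] at hs
        have := lt_of_mul_lt_mul_left (show L * (γ * -F x k) < L * (x k - a k) by
          linarith [(abs_le.1 hd).1]) hL.le
        linarith
    · rcases le_or_gt (F x k) 0 with h | h
      · rcases hbk.eq_or_lt with h' | h'
        · linarith [mul_neg_of_pos_of_neg hγ (hright k x hx h')]
        · linarith [mul_nonpos_of_nonneg_of_nonpos hγ.le h]
      · have hy := hmove k (b k) (hab k).le le_rfl
        have hd := abs_apply_sub_apply_add_single_le hLip hx hy k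
        have hyk : (x + EuclideanSpace.single k (b k - x k)) k = b k := by simp
        have hneg := hright k _ hy hyk
        have hmy := hmle ⟨k, _, hy, Or.inr hyk, rfl⟩
        rw [abs_of_neg hneg] at hmy
        rw [abs_of_nonpos (sub_nonpos.2 hbk)] at hd
        have hs := hstep k
        rw [abs_of_pos h] at hs
        have := lt_of_mul_lt_mul_left (show L * (γ * F x k) < L * -(x k - b k) by
          linarith [(abs_le.1 hd).2]) hL.le
        linarith
  refine interior_maximal (s := T)
    (t := WithLp.ofLp ⁻¹' (Set.pi Set.univ fun k ↦ Set.Ioo (a k) (b k))) ?_ ?_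
    (fun k _ ↦ hinner k)
  · rw [hTdef]
    exact Set.preimage_mono (Set.pi_mono fun k _ ↦ Set.Ioo_subset_Icc_self)
  · exact (isOpen_set_pi Set.finite_univ fun k _ ↦ isOpen_Ioo).preimage
      (PiLp.continuous_ofLp 2 _)
end

section
/- Let T = [a_1, b_1] × … × [a_N, b_N] ⊆ ℝ^N be a product of nondegenerate compact intervals and let F : ℝ^N → ℝ^N be Lipschitz continuous on T with Lipschitz constant at most L > 0 (with respect to the Euclidean norm on the domain). Fix a coordinate k and suppose F_k(y) > 0 for every y in the k-th left face of T, and set m_k = min over the k-th left face of F_k. Then for every x ∈ T with |x_k − a_k| < m_k / L, one has F_k(x) > 0. -/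
/-- Coordinate-wise estimate: if `F_k > 0` on the `k`-th left face, with minimum `m_k`, and
`F` is `L`-Lipschitz on `T`, then `F_k(x) > 0` for every `x ∈ T` with `|x_k - a_k| < m_k / L`. -/
theorem lipschitz_isolation_coordinate_estimate {N : ℕ}
    (a b : Fin N → ℝ) (hab : ∀ k, a k < b k)
    (F : EuclideanSpace ℝ (Fin N) → EuclideanSpace ℝ (Fin N))
    (T : Set (EuclideanSpace ℝ (Fin N)))
    (hTdef : T = WithLp.ofLp ⁻¹' (Set.pi Set.univ fun k => Set.Icc (a k) (b k)))
    (L : ℝ) (hL : 0 < L)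
    (hLip : ∀ x ∈ T, ∀ y ∈ T, ‖F x - F y‖ ≤ L * ‖x - y‖)
    (k : Fin N)
    (hpos : ∀ y ∈ T, y k = a k → 0 < F y k)
    (mk : ℝ)
    (hmk : IsLeast {v : ℝ | ∃ y ∈ T, y k = a k ∧ v = F y k} mk) :
    ∀ x ∈ T, |x k - a k| < mk / L → 0 < F x k := by
  intro x hx hxk
  set y := x - PiLp.single 2 k (x k - a k) with hy
  have hyk : y k = a k := by simp [hy]
  have hyT : y ∈ T := by
    subst hTdef
    intro j _
    have hxj := hx j (Set.mem_univ j)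
    by_cases hj : j = k
    · subst hj
      change y j ∈ Set.Icc (a j) (b j)
      rw [hyk]
      exact ⟨le_rfl, (hab j).le⟩
    · have hyj : y j = x j := by simp [hy, hj]
      change y j ∈ Set.Icc (a j) (b j)
      rwa [hyj]
  have hmin : mk ≤ F y k := hmk.2 ⟨y, hyT, hyk, rfl⟩
  have hnorm : ‖x - y‖ = |x k - a k| := by
    rw [hy, sub_sub_cancel, PiLp.norm_single, Real.norm_eq_abs]
  have hcoord : |F x k - F y k| ≤ ‖F x - F y‖ := PiLp.norm_apply_le (F x - F y) k
  have hdist : ‖F x - F y‖ ≤ L * |x k - a k| := hnorm ▸ hLip x hx y hyT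
  have hlt : |x k - a k| * L < mk := (lt_div_iff₀ hL).mp hxk
  linarith [neg_abs_le (F x k - F y k)]
end
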